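/- arXiv:2009.07952 — 2 statements merged into one kernel-verified Lean document; each statement's English description precedes it below -/
import Mathlib

section
/- For every T > 0 and every initial condition x̄ = (x̄_n)_{n≥1} with ∑_{n≥1} x̄_n² < ∞ (i.e. x̄ ∈ ℓ²), there exists at least one componentwise solution of the infinite mixed shell model on [0,T] with initial condition x̄. -/
open intervalIntegral

/-- Coefficients of the infinite mixed shell model: `k n = λ ^ n` for `n ≥ 2`,
`k 0 = k 1 = 0`. -/
noncomputable def mixedK (lam : ℝ) (n : ℕ) : ℝ :=
  if 2 ≤ n then lam ^ n else 0

/-- A componentwise solution of the infinite mixed shell model on `[0,T]` with initial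
condition `x̄` (components indexed by `n ≥ 1`, with the convention `X_0 ≡ 0`): continuous
functions satisfying the integral equation. -/
def IsCwShellSolution (lam T : ℝ) (xbar : ℕ → ℝ) (X : ℕ → ℝ → ℝ) : Prop :=
  (∀ t, X 0 t = 0) ∧
  ∀ n, 1 ≤ n →
    ContinuousOn (X n) (Set.Icc (0 : ℝ) T) ∧
    ∀ t ∈ Set.Icc (0 : ℝ) T,
      X n t = xbar n + ∫ s in (0 : ℝ)..t,
        (mixedK lam n * (X (n - 1) s) ^ 2
          - mixedK lam (n + 1) * X n s * X (n + 1) s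
          - mixedK lam n * (X (n + 1) s) ^ 2
          + mixedK lam (n - 1) * X (n - 1) s * X n s)

open Filter Topology Set

/-- The vector field of the mixed shell model. -/
noncomputable def shellField (lam : ℝ) (x : ℕ → ℝ) (n : ℕ) : ℝ :=
  mixedK lam n * (x (n - 1)) ^ 2 - mixedK lam (n + 1) * x n * x (n + 1)
    - mixedK lam n * (x (n + 1)) ^ 2 + mixedK lam (n - 1) * x (n - 1) * x n

/-- The sum of the absolute values of the coefficients in the `n`-th shell equation. -/
noncomputable def shellCoeff (lam : ℝ) (n : ℕ) : ℝ :=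
  |mixedK lam n| + |mixedK lam (n + 1)| + |mixedK lam n| + |mixedK lam (n - 1)|

lemma shellCoeff_nonneg (lam : ℝ) (n : ℕ) : 0 ≤ shellCoeff lam n := by
  unfold shellCoeff; positivity

lemma abs_mul_mul_sub_le {k a b a' b' R D : ℝ} (ha' : |a'| ≤ R) (hb : |b| ≤ R)
    (hda : |a - a'| ≤ D) (hdb : |b - b'| ≤ D) :
    |k * a * b - k * a' * b'| ≤ |k| * (2 * R * D) := by
  have hR : 0 ≤ R := (abs_nonneg _).trans hb
  have h : |(a - a') * b + a' * (b - b')| ≤ D * R + R * D := by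
    refine (abs_add_le _ _).trans ?_
    rw [abs_mul, abs_mul]
    gcongr
    exact (abs_nonneg _).trans hda
  calc |k * a * b - k * a' * b'| = |k| * |(a - a') * b + a' * (b - b')| := by
        rw [← abs_mul]; congr 1; ring
    _ ≤ |k| * (2 * R * D) := by gcongr; linarith

lemma abs_shellField_sub_le (lam : ℝ) {x y : ℕ → ℝ} {R D : ℝ} (hx : ∀ m, |x m| ≤ R)
    (hy : ∀ m, |y m| ≤ R) (n : ℕ) (h₁ : |x (n - 1) - y (n - 1)| ≤ D) (h₂ : |x n - y n| ≤ D)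
    (h₃ : |x (n + 1) - y (n + 1)| ≤ D) :
    |shellField lam x n - shellField lam y n| ≤ shellCoeff lam n * (2 * R * D) := by
  have e₁ := abs_le.1 <|
    abs_mul_mul_sub_le (k := mixedK lam n) (hy (n - 1)) (hx (n - 1)) h₁ h₁
  have e₂ := abs_le.1 <|
    abs_mul_mul_sub_le (k := mixedK lam (n + 1)) (hy n) (hx (n + 1)) h₂ h₃
  have e₃ := abs_le.1 <|
    abs_mul_mul_sub_le (k := mixedK lam n) (hy (n + 1)) (hx (n + 1)) h₃ h₃
  have e₄ := abs_le.1 <|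
    abs_mul_mul_sub_le (k := mixedK lam (n - 1)) (hy (n - 1)) (hx n) h₁ h₂
  rw [abs_le]
  unfold shellField shellCoeff
  constructor <;> linarith

lemma abs_shellField_le (lam : ℝ) {x : ℕ → ℝ} {R : ℝ} (hx : ∀ m, |x m| ≤ R) (n : ℕ) :
    |shellField lam x n| ≤ shellCoeff lam n * (2 * R ^ 2) := by
  have hR : 0 ≤ R := (abs_nonneg _).trans (hx 0)
  have h0 : shellField lam (fun _ => 0) n = 0 := by simp [shellField]
  have := abs_shellField_sub_le lam (y := fun _ => 0) hx (by simpa using hR) n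
    (by simpa using hx _) (by simpa using hx _) (by simpa using hx _)
  rw [h0, sub_zero] at this
  linarith

/-- The energy flux through the first `N` shells telescopes. -/
lemma sum_mul_shellField (lam : ℝ) {x : ℕ → ℝ} (h0 : x 0 = 0) (N : ℕ) :
    ∑ i ∈ Finset.range N, x (i + 1) * shellField lam x (i + 1) =
      -(mixedK lam (N + 1) * x N ^ 2 * x (N + 1)) - mixedK lam N * x N * x (N + 1) ^ 2 := by
  induction N with
  | zero => simp [h0, mixedK]
  | succ N ih =>
    rw [Finset.sum_range_succ, ih]
    simp only [shellField, Nat.add_sub_cancel]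
    ring

/-- A `C¹` bounded vector field in finite dimension has solutions on every `[0, T]`. -/
lemma exists_hasDerivWithinAt_of_contDiff_of_bounded {E : Type*} [NormedAddCommGroup E]
    [NormedSpace ℝ E] [FiniteDimensional ℝ E] {G : E → E} (hG : ContDiff ℝ 1 G) {L : ℝ}
    (hL : ∀ v, ‖G v‖ ≤ L) {T : ℝ} (hT : 0 ≤ T) (x₀ : E) :
    ∃ α : ℝ → E, α 0 = x₀ ∧ ∀ t ∈ Icc 0 T, HasDerivWithinAt α (G (α t)) (Icc 0 T) t := by
  have : ProperSpace E := FiniteDimensional.proper ℝ E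
  have hL0 : 0 ≤ L := (norm_nonneg _).trans (hL 0)
  lift L to NNReal using hL0
  lift T to NNReal using hT
  obtain ⟨K, hK⟩ := hG.contDiffOn.exists_lipschitzOnWith
    (s := Metric.closedBall x₀ (L * T : NNReal)) one_ne_zero (convex_closedBall _ _) (isCompact_closedBall _ _)
  have hPL : IsPicardLindelof (fun _ => G) (⟨0, by simp⟩ : Icc (0 : ℝ) T) x₀ (L * T) 0 L K :=
    { lipschitzOnWith := fun _ _ => hK
      continuousOn := fun _ _ => continuousOn_const
      norm_le := fun _ _ _ _ => hL _
      mul_max_le := by simp }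
  exact hPL.exists_eq_forall_mem_Icc_hasDerivWithinAt₀

/-- Extension of a vector of the first `N` shells to all shells by zero. -/
noncomputable def shellExtend {N : ℕ} (v : Fin N → ℝ) : ℕ → ℝ
  | 0 => 0
  | n + 1 => if h : n < N then v ⟨n, h⟩ else 0

lemma shellExtend_fin {N : ℕ} (v : Fin N → ℝ) (i : Fin N) : shellExtend v (i + 1) = v i := by
  simp [shellExtend]

lemma shellExtend_of_lt {N n : ℕ} (v : Fin N → ℝ) (h : N < n) : shellExtend v n = 0 := by
  cases n with
  | zero => rfl
  | succ n => simp [shellExtend, show ¬ n < N by omega]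

lemma contDiff_shellExtend (N n : ℕ) :
    ContDiff ℝ 1 (fun v : Fin N → ℝ => shellExtend v n) := by
  cases n with
  | zero => exact contDiff_const
  | succ n =>
    by_cases h : n < N
    · simp only [shellExtend, h, dite_true]
      exact contDiff_apply ℝ ℝ _
    · simp only [shellExtend, h, dite_false]
      exact contDiff_const

lemma sq_shellExtend_le {N : ℕ} (v : Fin N → ℝ) (n : ℕ) :
    shellExtend v n ^ 2 ≤ ∑ i, v i ^ 2 := by
  have h0 : 0 ≤ ∑ i, v i ^ 2 := Finset.sum_nonneg fun i _ => sq_nonneg _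
  cases n with
  | zero => simpa [shellExtend] using h0
  | succ n =>
    by_cases h : n < N
    · simp only [shellExtend, h, dite_true]
      exact Finset.single_le_sum (f := fun i => v i ^ 2) (fun i _ => sq_nonneg _)
        (Finset.mem_univ (⟨n, h⟩ : Fin N))
    · simpa [shellExtend, h] using h0

lemma sum_mul_shellField_shellExtend (lam : ℝ) {N : ℕ} (v : Fin N → ℝ) :
    ∑ i : Fin N, v i * shellField lam (shellExtend v) (i + 1) = 0 := by
  have h := sum_mul_shellField lam (x := shellExtend v) rfl N
  rw [Finset.sum_range, shellExtend_of_lt v (Nat.lt_succ_self N)] at h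
  simpa [shellExtend_fin] using h

/-- Galerkin truncation: the shell model restricted to the first `N` shells has an
energy-preserving solution on `[0, T]`. -/
lemma exists_galerkin (lam : ℝ) {T : ℝ} (hT : 0 ≤ T) {N : ℕ} (v₀ : Fin N → ℝ) :
    ∃ v : ℝ → Fin N → ℝ, v 0 = v₀ ∧
      (∀ t ∈ Icc 0 T, ∑ i, v t i ^ 2 = ∑ i, v₀ i ^ 2) ∧
      ∀ t ∈ Icc 0 T, ∀ i : Fin N, HasDerivWithinAt (fun s => v s i)
        (shellField lam (shellExtend (v t)) (i + 1)) (Icc 0 T) t := by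
  set E : ℝ := ∑ i, v₀ i ^ 2 with hE
  have hE0 : 0 ≤ E := Finset.sum_nonneg fun i _ => sq_nonneg _
  have hpos : ∀ v : Fin N → ℝ, 0 < 1 + ∑ i, v i ^ 2 := fun v => by positivity
  -- the factor makes the field bounded, and equals `1` on the energy sphere of `v₀`
  let G : (Fin N → ℝ) → Fin N → ℝ := fun v i =>
    (1 + E) / (1 + ∑ j, v j ^ 2) * shellField lam (shellExtend v) (i + 1)
  have hG : ContDiff ℝ 1 G := by
    refine contDiff_pi.2 fun i => ?_
    have hc : ∀ n, ContDiff ℝ 1 (fun v : Fin N → ℝ => shellExtend v n) := contDiff_shellExtend N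
    refine (contDiff_const.div ?_ fun v => (hpos v).ne').mul ?_
    · exact contDiff_const.add (ContDiff.sum fun j _ => (contDiff_apply ℝ ℝ j).pow 2)
    · unfold shellField
      exact (((contDiff_const.mul ((hc _).pow 2)).sub ((contDiff_const.mul (hc _)).mul (hc _))).sub
        (contDiff_const.mul ((hc _).pow 2))).add ((contDiff_const.mul (hc _)).mul (hc _))
  have hbound : ∀ v, ‖G v‖ ≤ ∑ i : Fin N, 2 * (1 + E) * shellCoeff lam (i + 1) := by
    intro v
    have hnn : ∀ i : Fin N, 0 ≤ 2 * (1 + E) * shellCoeff lam (i + 1) := fun i =>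
      mul_nonneg (by positivity) (shellCoeff_nonneg _ _)
    refine (pi_norm_le_iff_of_nonneg (Finset.sum_nonneg fun i _ => hnn i)).2 fun i => ?_
    refine le_trans ?_ (Finset.single_le_sum (fun i _ => hnn i) (Finset.mem_univ i))
    have hS : 0 ≤ ∑ j, v j ^ 2 := Finset.sum_nonneg fun i _ => sq_nonneg _
    have hF := abs_shellField_le lam (x := shellExtend v) (R := √(∑ j, v j ^ 2))
      (fun m => Real.abs_le_sqrt (sq_shellExtend_le v m)) (i + 1)
    rw [Real.sq_sqrt hS] at hF
    have hC := shellCoeff_nonneg lam (i + 1)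
    rw [Real.norm_eq_abs, abs_mul, abs_of_nonneg (div_nonneg (by linarith) (hpos v).le),
      div_mul_eq_mul_div, div_le_iff₀ (hpos v)]
    calc (1 + E) * |shellField lam (shellExtend v) (i + 1)|
        ≤ (1 + E) * (shellCoeff lam (i + 1) * (2 * (1 + ∑ j, v j ^ 2))) := by
          gcongr
          refine hF.trans ?_
          gcongr
          linarith
      _ = _ := by ring
  obtain ⟨v, hv0, hv⟩ := exists_hasDerivWithinAt_of_contDiff_of_bounded hG hbound hT v₀
  have hvi : ∀ t ∈ Icc 0 T, ∀ i, HasDerivWithinAt (fun s => v s i) (G (v t) i) (Icc 0 T) t :=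
    fun t ht => hasDerivWithinAt_pi.1 (hv t ht)
  have hen : ∀ t ∈ Icc 0 T, HasDerivWithinAt (fun s => ∑ i, v s i ^ 2) 0 (Icc 0 T) t := by
    intro t ht
    have h := HasDerivWithinAt.fun_sum (u := Finset.univ) fun i _ => (hvi t ht i).pow 2
    refine h.congr_deriv (Eq.symm ?_)
    have := sum_mul_shellField_shellExtend lam (v t)
    calc (0 : ℝ) = 2 * ((1 + E) / (1 + ∑ j, v t j ^ 2)) *
          ∑ i : Fin N, v t i * shellField lam (shellExtend (v t)) (i + 1) := by rw [this, mul_zero]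
      _ = _ := by
        rw [Finset.mul_sum]
        refine Finset.sum_congr rfl fun i _ => ?_
        simp only [G]
        push_cast
        ring
  have hconst : ∀ t ∈ Icc 0 T, ∑ i, v t i ^ 2 = E := by
    intro t ht
    have h := (convex_Icc 0 T).norm_image_sub_le_of_norm_hasDerivWithin_le (C := 0) hen
      (fun _ _ => by simp) (left_mem_Icc.2 hT) ht
    rw [zero_mul, norm_le_zero_iff, sub_eq_zero, hv0] at h
    exact h
  refine ⟨v, hv0, hconst, fun t ht i => ?_⟩
  have h := hvi t ht i
  simp only [G, hconst t ht] at h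
  rwa [div_self (by positivity), one_mul] at h

/-- Galerkin approximations with bounds uniform in the truncation level: the increments of each
component are controlled to second order by the vector field. -/
lemma exists_approx (lam : ℝ) {T : ℝ} (hT : 0 ≤ T) (xbar : ℕ → ℝ) {R : ℝ} (hR : 0 ≤ R)
    (N : ℕ) (hxR : ∑ i ∈ Finset.range N, xbar (i + 1) ^ 2 ≤ R ^ 2) :
    ∃ X : ℝ → ℕ → ℝ, (∀ t, X t 0 = 0) ∧ (∀ n, 1 ≤ n → n ≤ N → X 0 n = xbar n) ∧
      (∀ t ∈ Icc 0 T, ∀ n, |X t n| ≤ R) ∧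
      ∀ n, 1 ≤ n → n ≤ N → ∀ s ∈ Icc 0 T, ∀ t ∈ Icc 0 T,
        |X t n - X s n - (t - s) * shellField lam (X s) n| ≤
          shellCoeff lam n * (2 * R * ((shellCoeff lam (n - 1) + shellCoeff lam n +
            shellCoeff lam (n + 1)) * (2 * R ^ 2))) * |t - s| ^ 2 := by
  obtain ⟨v, hv0, hen, hder⟩ := exists_galerkin lam hT (fun i : Fin N => xbar (i + 1))
  have hder' : ∀ n, 1 ≤ n → n ≤ N → ∀ t ∈ Icc 0 T, HasDerivWithinAt
      (fun s => shellExtend (v s) n) (shellField lam (shellExtend (v t)) n) (Icc 0 T) t := by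
    intro n h1 hN t ht
    obtain ⟨m, rfl⟩ : ∃ m, n = m + 1 := ⟨n - 1, by omega⟩
    simpa [shellExtend, show m < N from hN] using hder t ht ⟨m, hN⟩
  have hb : ∀ t ∈ Icc 0 T, ∀ n, |shellExtend (v t) n| ≤ R := by
    intro t ht n
    refine abs_le_of_sq_le_sq ((sq_shellExtend_le _ n).trans ?_) hR
    rw [hen t ht, ← Finset.sum_range (fun i => xbar (i + 1) ^ 2)]
    exact hxR
  have hlip : ∀ n, ∀ s ∈ Icc 0 T, ∀ t ∈ Icc 0 T, |shellExtend (v t) n - shellExtend (v s) n| ≤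
      shellCoeff lam n * (2 * R ^ 2) * |t - s| := by
    intro n s hs t ht
    by_cases hn : 1 ≤ n ∧ n ≤ N
    · exact (convex_Icc 0 T).norm_image_sub_le_of_norm_hasDerivWithin_le (hder' n hn.1 hn.2)
        (fun u hu => abs_shellField_le lam (hb u hu) n) hs ht
    · have h0 : ∀ u, shellExtend (v u) n = 0 := fun u => by
        rcases Nat.eq_zero_or_pos n with rfl | h
        · rfl
        · exact shellExtend_of_lt _ (by omega)
      have := shellCoeff_nonneg lam n
      rw [h0, h0, sub_zero, abs_zero]
      positivity
  refine ⟨fun t => shellExtend (v t), fun t => rfl, ?_, hb, ?_⟩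
  · intro n h1 hN
    obtain ⟨m, rfl⟩ : ∃ m, n = m + 1 := ⟨n - 1, by omega⟩
    simp [shellExtend, show m < N from hN, hv0]
  · intro n h1 hN s hs t ht
    have c₁ := shellCoeff_nonneg lam (n - 1)
    have c₂ := shellCoeff_nonneg lam n
    have c₃ := shellCoeff_nonneg lam (n + 1)
    have hsub : uIcc s t ⊆ Icc 0 T := (convex_Icc 0 T).ordConnected.uIcc_subset hs ht
    have hd : ∀ u ∈ uIcc s t, HasDerivWithinAt
        (fun u => shellExtend (v u) n - u * shellField lam (shellExtend (v s)) n)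
        (shellField lam (shellExtend (v u)) n - shellField lam (shellExtend (v s)) n)
        (uIcc s t) u := fun u hu => by
      simpa using ((hder' n h1 hN u (hsub hu)).mono hsub).fun_sub
        ((hasDerivWithinAt_id u (uIcc s t)).mul_const (shellField lam (shellExtend (v s)) n))
    have key := (convex_uIcc s t).norm_image_sub_le_of_norm_hasDerivWithin_le
      (C := shellCoeff lam n * (2 * R * ((shellCoeff lam (n - 1) + shellCoeff lam n +
            shellCoeff lam (n + 1)) * (2 * R ^ 2) * |t - s|))) hd
      (fun u hu => by
        have hu' := hsub hu
        have hus : |u - s| ≤ |t - s| := abs_sub_left_of_mem_uIcc hu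
        refine abs_shellField_sub_le lam (hb u hu') (hb s hs) n ?_ ?_ ?_ <;>
        · refine (hlip _ s hs u hu').trans ?_
          gcongr
          linarith)
      left_mem_uIcc right_mem_uIcc
    rw [Real.norm_eq_abs, Real.norm_eq_abs] at key
    calc _ = |shellExtend (v t) n - t * shellField lam (shellExtend (v s)) n -
          (shellExtend (v s) n - s * shellField lam (shellExtend (v s)) n)| := by
          congr 1; ring
      _ ≤ _ := key
      _ = _ := by ring

lemma hasDerivWithinAt_of_abs_sub_le_sq {f : ℝ → ℝ} {f' C s : ℝ} {S : Set ℝ}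
    (h : ∀ t ∈ S, |f t - f s - (t - s) * f'| ≤ C * |t - s| ^ 2) :
    HasDerivWithinAt f f' S s := by
  rw [hasDerivWithinAt_iff_isLittleO]
  have h1 : (fun t => f t - f s - (t - s) • f') =O[𝓝[S] s] fun t => (t - s) ^ 2 :=
    Asymptotics.IsBigO.of_bound C <| eventually_mem_nhdsWithin.mono fun t ht => by
      simpa using h t ht
  refine h1.trans_isLittleO ?_
  have h2 : Tendsto (fun t => t - s) (𝓝[S] s) (𝓝 0) := by
    have : Tendsto (fun t => t - s) (𝓝 s) (𝓝 (s - s)) :=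
      (continuous_id.sub continuous_const).tendsto s
    rw [sub_self] at this
    exact this.mono_left nhdsWithin_le_nhds
  exact (Asymptotics.isLittleO_pow_id one_lt_two).comp_tendsto h2

/-- for every `T > 0` and every `ℓ²` initial condition `x̄ = (x̄_n)_{n≥1}`,
the infinite mixed shell model admits at least one componentwise solution on `[0,T]`. -/
theorem mixed_shell_exists_l2 (lam : ℝ) (hlam : 1 < lam) (T : ℝ) (hT : 0 < T)
    (xbar : ℕ → ℝ) (hl2 : Summable fun n : ℕ => (xbar (n + 1)) ^ 2) :
    ∃ X : ℕ → ℝ → ℝ, IsCwShellSolution lam T xbar X := by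
  set R : ℝ := √(∑' n, xbar (n + 1) ^ 2) with hRdef
  have hR : 0 ≤ R := Real.sqrt_nonneg _
  have hxR : ∀ N, ∑ i ∈ Finset.range N, xbar (i + 1) ^ 2 ≤ R ^ 2 := fun N => by
    rw [Real.sq_sqrt (tsum_nonneg fun _ => sq_nonneg _)]
    exact hl2.sum_le_tsum _ fun _ _ => sq_nonneg _
  choose Y hY0 hYinit hYb hYd using fun N => exists_approx lam hT.le xbar hR N (hxR N)
  have hlim : ∀ t n, ∃ l, t ∈ Icc 0 T → Tendsto (fun N => Y N t n) (hyperfilter ℕ) (𝓝 l) := by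
    intro t n
    by_cases ht : t ∈ Icc 0 T
    · obtain ⟨l, -, hl⟩ := (isCompact_Icc (a := -R) (b := R)).ultrafilter_le_nhds'
        ((hyperfilter ℕ).map fun N => Y N t n)
        (Ultrafilter.mem_map.2 (univ_mem' fun N => abs_le.1 (hYb N t ht n)))
      exact ⟨l, fun _ => hl⟩
    · exact ⟨0, fun h => absurd h ht⟩
  choose X hX using hlim
  have h0T : (0 : ℝ) ∈ Icc 0 T := left_mem_Icc.2 hT.le
  have hlarge : ∀ n, ∀ᶠ N in (hyperfilter ℕ : Filter ℕ), n ≤ N := fun n =>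
    Nat.hyperfilter_le_atTop (eventually_ge_atTop n)
  have hX0 : ∀ t ∈ Icc 0 T, X t 0 = 0 := fun t ht =>
    tendsto_nhds_unique (hX t 0 ht) (by simp [hY0])
  have hXinit : ∀ n, 1 ≤ n → X 0 n = xbar n := fun n hn =>
    tendsto_nhds_unique (hX 0 n h0T) <| tendsto_const_nhds.congr' <|
      (hlarge n).mono fun N hN => (hYinit N n hn hN).symm
  have hF : ∀ t ∈ Icc 0 T, ∀ n, Tendsto (fun N => shellField lam (Y N t) n) (hyperfilter ℕ)
      (𝓝 (shellField lam (X t) n)) := fun t ht n =>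
    (((((hX t _ ht).pow 2).const_mul _).sub (((hX t _ ht).const_mul _).mul (hX t _ ht))).sub
      (((hX t _ ht).pow 2).const_mul _)).add (((hX t _ ht).const_mul _).mul (hX t _ ht))
  have hder : ∀ n, 1 ≤ n → ∀ s ∈ Icc 0 T,
      HasDerivWithinAt (fun t => X t n) (shellField lam (X s) n) (Icc 0 T) s := by
    intro n hn s hs
    refine hasDerivWithinAt_of_abs_sub_le_sq (C := shellCoeff lam n * (2 * R *
      ((shellCoeff lam (n - 1) + shellCoeff lam n + shellCoeff lam (n + 1)) * (2 * R ^ 2))))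
      fun t ht => ?_
    exact le_of_tendsto
      (((hX t n ht).sub (hX s n hs)).sub ((hF s hs n).const_mul (t - s))).abs
      ((hlarge n).mono fun N hN => hYd N n hn hN s hs t ht)
  have hcont : ∀ n, ContinuousOn (fun t => X t n) (Icc 0 T) := by
    intro n
    rcases Nat.eq_zero_or_pos n with rfl | hn
    · exact continuousOn_const.congr hX0
    · exact fun s hs => (hder n hn s hs).continuousWithinAt
  have hFcont : ∀ n, ContinuousOn (fun t => shellField lam (X t) n) (Icc 0 T) := fun n =>
    ((((continuousOn_const.mul ((hcont _).pow 2)).sub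
      ((continuousOn_const.mul (hcont _)).mul (hcont _))).sub
      (continuousOn_const.mul ((hcont _).pow 2))).add
      ((continuousOn_const.mul (hcont _)).mul (hcont _)))
  -- off `[0, T]` the zeroth component has to be set to `0` by hand
  let Z : ℕ → ℝ → ℝ := fun n t => if n = 0 then 0 else X t n
  have hZ : ∀ n, ∀ t ∈ Icc 0 T, Z n t = X t n := by
    intro n t ht
    by_cases hn : n = 0
    · simp [Z, hn, hX0 t ht]
    · simp [Z, hn]
  refine ⟨Z, fun t => by simp [Z], fun n hn => ⟨(hcont n).congr (hZ n), fun t ht => ?_⟩⟩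
  have hsub : Icc 0 t ⊆ Icc 0 T := Icc_subset_Icc_right ht.2
  have hint := integral_eq_sub_of_hasDerivAt_of_le ht.1 ((hcont n).mono hsub)
    (fun s hs => (hder n hn s (hsub (Ioo_subset_Icc_self hs))).hasDerivAt
      (Icc_mem_nhds hs.1 (hs.2.trans_le ht.2)))
    (((hFcont n).mono hsub).intervalIntegrable_of_Icc ht.1)
  rw [hXinit n hn] at hint
  rw [hZ n t ht, ← sub_eq_iff_eq_add', ← hint]
  refine integral_congr fun s hs => ?_
  rw [uIcc_of_le ht.1] at hs
  have hs' := hsub hs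
  simp only [hZ _ s hs', shellField]
end

section
/- Let (Ω, F, P, U) be an N-finite random solution with parameter r > 0. Then for every t ∈ [0,T], the law on ℝ^{ℕ≥1} of the random variable ω ↦ (U_n(ω,t))_{n≥1} equals the product measure μ̃_r^N := (⊗_{n=1}^N N(0,r²)) ⊗ (⊗_{n>N} δ_0), where δ_0 is the Dirac measure at 0; in particular the law of U(·,t) does not depend on t. -/
open MeasureTheory ProbabilityTheory

/-- Coefficients of the N-dimensional shell model. -/
noncomputable def shellK (lam : ℝ) (N : ℕ) (n : ℕ) : ℝ :=
  if 1 < n ∧ n < N then lam ^ n else 0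

/-- A solution of the `N`-dimensional shell model on `[0,T]`, conventions `X_0 ≡ 0`,
`X_{N+1} ≡ 0`. -/
def IsShellSolution (lam : ℝ) (N : ℕ) (T : ℝ) (X : ℝ → ℕ → ℝ) : Prop :=
  (∀ t, X t 0 = 0) ∧ (∀ t, X t (N + 1) = 0) ∧
  ∀ n, 1 ≤ n → n ≤ N → ∀ t ∈ Set.Icc (0 : ℝ) T,
    HasDerivWithinAt (fun u => X u n)
      (shellK lam N n * (X t (n - 1)) ^ 2
        - shellK lam N (n + 1) * X t n * X t (n + 1)
        - shellK lam N n * (X t (n + 1)) ^ 2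
        + shellK lam N (n - 1) * X t (n - 1) * X t n)
      (Set.Icc (0 : ℝ) T) t

/-- An `N`-finite random solution with parameter `r > 0`: a jointly measurable
`U : Ω × ℝ → ℝ^{ℕ≥1}` (component `n ≥ 1` of `U ω t` is `U ω t n`; index `0` is the
conventional component `X_0 ≡ 0`) such that `U_n ≡ 0` for `n > N`, every path is a
solution of the `N`-dimensional shell model on `[0,T]`, and
`ω ↦ (U_1(ω,0),…,U_N(ω,0))` has law `μ_r^N = ⊗_{n=1}^N N(0,r²)`. -/
def IsNFiniteRandomSolution (lam T r : ℝ) (N : ℕ) {Ω : Type*} [MeasurableSpace Ω]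
    (P : Measure Ω) (U : Ω → ℝ → ℕ → ℝ) : Prop :=
  Measurable (fun p : Ω × ℝ => U p.1 p.2) ∧
  (∀ ω t, ∀ n, N < n → U ω t n = 0) ∧
  (∀ ω, IsShellSolution lam N T (U ω)) ∧
  Measure.map (fun ω => fun i : Fin N => U ω 0 ((i : ℕ) + 1)) P
    = Measure.pi fun _ : Fin N => gaussianReal 0 (r ^ 2).toNNReal

namespace ShellModel

/-- The vector field of the shell model with coefficients `k`. -/
def vectorField (k : ℕ → ℝ) (x : ℕ → ℝ) (n : ℕ) : ℝ :=
  k n * x (n - 1) ^ 2 - k (n + 1) * x n * x (n + 1) - k n * x (n + 1) ^ 2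
    + k (n - 1) * x (n - 1) * x n

/-- The coefficients of the four quadratic terms of the `n`-th component of the vector field. -/
def coeff (k : ℕ → ℝ) (n : ℕ) : Fin 4 → ℝ := ![k n, -k (n + 1), -k n, k (n - 1)]

/-- The index of the first factor of each quadratic term of the `n`-th component. -/
def leftIndex (n : ℕ) : Fin 4 → ℕ := ![n - 1, n, n + 1, n - 1]

/-- The index of the second factor of each quadratic term of the `n`-th component. -/
def rightIndex (n : ℕ) : Fin 4 → ℕ := ![n - 1, n + 1, n + 1, n]

theorem vectorField_eq_sum (k x : ℕ → ℝ) (n : ℕ) :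
    vectorField k x n = ∑ q, coeff k n q * (x (leftIndex n q) * x (rightIndex n q)) := by
  simp only [vectorField, coeff, leftIndex, rightIndex, Fin.sum_univ_four]
  simp
  ring

/-- The word obtained from `w` by replacing its `i`-th letter with the two letters of the `q`-th
quadratic term of the corresponding component of the vector field. -/
def extWord {d : ℕ} (w : Fin d → ℕ) (i : Fin d) (q : Fin 4) : Fin (d + 1) → ℕ :=
  Fin.cons (leftIndex (w i) q) (Function.update w i (rightIndex (w i) q))

/-- The action of the Liouville operator on a family of functionals indexed by words. -/
def wordSum (k : ℕ → ℝ) (F : (d : ℕ) → (Fin d → ℕ) → ℝ) (d : ℕ) (w : Fin d → ℕ) : ℝ :=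
  ∑ i, ∑ q, coeff k (w i) q * F (d + 1) (extWord w i q)

/-- The energy carried by the components `0, …, N`. -/
def energy (N : ℕ) (x : ℕ → ℝ) : ℝ := ∑ n ∈ Finset.range (N + 1), x n ^ 2

/-- A radial factor times the monomial attached to a word. -/
def testFun (N : ℕ) (θ : ℝ → ℝ) (x : ℕ → ℝ) (d : ℕ) (w : Fin d → ℕ) : ℝ :=
  θ (energy N x) * ∏ i, x (w i)

theorem prod_extWord {d : ℕ} (w : Fin d → ℕ) (i : Fin d) (q : Fin 4) (x : ℕ → ℝ) :
    ∏ j, x (extWord w i q j) =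
      (∏ j ∈ Finset.univ.erase i, x (w j)) *
        (x (leftIndex (w i) q) * x (rightIndex (w i) q)) := by
  rw [Fin.prod_univ_succ, ← Finset.mul_prod_erase Finset.univ _ (Finset.mem_univ i)]
  have : ∏ j ∈ Finset.univ.erase i, x (extWord w i q j.succ)
      = ∏ j ∈ Finset.univ.erase i, x (w j) := by
    refine Finset.prod_congr rfl fun j hj => ?_
    simp [extWord, Function.update_of_ne (Finset.ne_of_mem_erase hj)]
  rw [this]
  simp [extWord]
  ring

theorem shellK_zero (lam : ℝ) (N : ℕ) : shellK lam N 0 = 0 := by simp [shellK]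

theorem shellK_one (lam : ℝ) (N : ℕ) : shellK lam N 1 = 0 := by simp [shellK]

theorem shellK_of_le (lam : ℝ) {N n : ℕ} (h : N ≤ n) : shellK lam N n = 0 := by
  simp only [shellK, ite_eq_right_iff]
  omega

theorem abs_shellK_le {lam : ℝ} (hlam : 1 < lam) (N n : ℕ) : |shellK lam N n| ≤ lam ^ N := by
  unfold shellK
  split_ifs with h
  · rw [abs_of_nonneg (by positivity)]
    exact pow_le_pow_right₀ hlam.le h.2.le
  · simp only [abs_zero]
    positivity

theorem abs_coeff_le {lam : ℝ} (hlam : 1 < lam) (N n : ℕ) (q : Fin 4) :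
    |coeff (shellK lam N) n q| ≤ lam ^ N := by
  fin_cases q <;> simp [coeff, abs_shellK_le hlam]

theorem vectorField_of_notMem (lam : ℝ) {N n : ℕ} {x : ℕ → ℝ} (hx : ∀ n, N < n → x n = 0)
    (h : ¬(1 ≤ n ∧ n ≤ N)) : vectorField (shellK lam N) x n = 0 := by
  rcases Nat.eq_zero_or_pos n with rfl | hn
  · simp [vectorField, shellK_zero, shellK_one]
  · have hN : N < n := by omega
    simp [vectorField, shellK_of_le lam hN.le, shellK_of_le lam (hN.le.trans n.le_succ), hx n hN]

theorem sum_mul_vectorField (lam : ℝ) {N : ℕ} {x : ℕ → ℝ} (hx : ∀ n, N < n → x n = 0) :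
    ∑ n ∈ Finset.range (N + 1), x n * vectorField (shellK lam N) x n = 0 := by
  have key : ∀ M, ∑ n ∈ Finset.range (M + 1), x n * vectorField (shellK lam N) x n =
      -(shellK lam N (M + 1) * x M ^ 2 * x (M + 1) + shellK lam N M * x M * x (M + 1) ^ 2) := by
    intro M
    induction M with
    | zero => simp [vectorField, shellK_zero, shellK_one]
    | succ M ih =>
      rw [Finset.sum_range_succ, ih]
      simp only [vectorField, Nat.add_sub_cancel]
      ring
  rw [key, hx (N + 1) N.lt_succ_self]
  ring

theorem sum_divergence (lam : ℝ) (N : ℕ) (x : ℕ → ℝ) :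
    ∑ n ∈ Finset.range (N + 1),
      (shellK lam N (n - 1) * x (n - 1) - shellK lam N (n + 1) * x (n + 1)) = 0 := by
  have key : ∀ M, ∑ n ∈ Finset.range (M + 1),
      (shellK lam N (n - 1) * x (n - 1) - shellK lam N (n + 1) * x (n + 1)) =
      -(shellK lam N (M + 1) * x (M + 1) + shellK lam N M * x M) := by
    intro M
    induction M with
    | zero => simp [shellK_zero, shellK_one]
    | succ M ih =>
      rw [Finset.sum_range_succ, ih, Nat.add_sub_cancel]
      ring
  rw [key, shellK_of_le lam N.le_succ, shellK_of_le lam le_rfl]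
  ring

/-- Along a curve whose velocity is the vector field, a test function evolves through the
Liouville operator. -/
theorem hasDerivWithinAt_testFun (lam : ℝ) {N : ℕ} {θ : ℝ → ℝ} (hθ : Differentiable ℝ θ)
    {y : ℝ → ℕ → ℝ} {s : Set ℝ} {t : ℝ} (hy : ∀ n, N < n → y t n = 0)
    (h : ∀ n, HasDerivWithinAt (fun u => y u n) (vectorField (shellK lam N) (y t) n) s t)
    (d : ℕ) (w : Fin d → ℕ) :
    HasDerivWithinAt (fun u => testFun N θ (y u) d w)
      (wordSum (shellK lam N) (testFun N θ (y t)) d w) s t := by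
  have hE : HasDerivWithinAt (fun u => energy N (y u)) 0 s t := by
    have := HasDerivWithinAt.fun_sum (u := Finset.range (N + 1)) fun n _ => (h n).fun_pow 2
    refine this.congr_deriv ?_
    have h0 := sum_mul_vectorField lam hy
    simp only [Nat.cast_ofNat, Nat.add_one_sub_one, pow_one, mul_assoc]
    rw [← Finset.mul_sum, h0, mul_zero]
  have hT := (hθ (energy N (y t))).hasDerivAt.comp_hasDerivWithinAt t hE
  have hP := HasDerivWithinAt.fun_finsetProd (u := Finset.univ) fun i _ => h (w i)
  refine (hT.fun_mul hP).congr_deriv ?_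
  simp only [wordSum, testFun, prod_extWord, mul_zero, zero_mul, zero_add, smul_eq_mul,
    Finset.mul_sum, vectorField_eq_sum, Function.comp_apply]
  exact Finset.sum_congr rfl fun i _ => Finset.sum_congr rfl fun q _ => by ring

theorem abs_testFun_le {N : ℕ} {θ : ℝ → ℝ} {R : ℝ} (hR : 0 ≤ R) (h1 : ∀ s, |θ s| ≤ 1)
    (h0 : ∀ s, R ^ 2 ≤ s → θ s = 0) {x : ℕ → ℝ} (hx : ∀ n, N < n → x n = 0) (d : ℕ)
    (w : Fin d → ℕ) : |testFun N θ x d w| ≤ R ^ d := by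
  unfold testFun
  rcases le_or_gt (R ^ 2) (energy N x) with h | h
  · rw [h0 _ h, zero_mul, abs_zero]
    positivity
  · have hn : ∀ n, |x n| ≤ R := by
      intro n
      rcases le_or_gt n N with hn | hn
      · refine abs_le_of_sq_le_sq (le_trans ?_ h.le) hR
        exact Finset.single_le_sum (f := fun n => x n ^ 2) (fun i _ => sq_nonneg _)
          (Finset.mem_range.2 (Nat.lt_succ_of_le hn))
      · rwa [hx n hn, abs_zero]
    rw [abs_mul, Finset.abs_prod]
    calc |θ (energy N x)| * ∏ i, |x (w i)| ≤ 1 * ∏ _i : Fin d, R :=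
          mul_le_mul (h1 _) (Finset.prod_le_prod (fun _ _ => abs_nonneg _) fun i _ => hn _)
            (Finset.prod_nonneg fun _ _ => abs_nonneg _) zero_le_one
      _ = R ^ d := by simp

/-- Cauchy–Kovalevskaya type majorant for a family vanishing at time `s` and evolving through the
Liouville operator. -/
theorem abs_le_of_integral_wordSum {k : ℕ → ℝ} {K R C s T : ℝ} (hK : ∀ n q, |coeff k n q| ≤ K)
    {D : ℝ → (d : ℕ) → (Fin d → ℕ) → ℝ}
    (hD : ∀ t ∈ Set.Icc s T, ∀ d w, |D t d w| ≤ C * R ^ d)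
    (hint : ∀ t ∈ Set.Icc s T, ∀ d w, D t d w = ∫ u in s..t, wordSum k (D u) d w)
    (n : ℕ) : ∀ t ∈ Set.Icc s T, ∀ d w,
      |D t d w| ≤ C * R ^ d * (d.ascFactorial n / n.factorial) * (4 * K * R * (t - s)) ^ n := by
  have hK0 : 0 ≤ K := (abs_nonneg _).trans (hK 0 0)
  induction n with
  | zero => simpa using hD
  | succ n ih =>
    intro t ht d w
    rw [hint t ht d w, ← Real.norm_eq_abs]
    set A : ℝ := C * R ^ (d + 1) * ((d + 1).ascFactorial n / n.factorial) * (4 * K * R) ^ n with hA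
    have hbd : ∀ u ∈ Set.Ioc s t, ‖wordSum k (D u) d w‖ ≤ d * 4 * K * A * (u - s) ^ n := by
      intro u hu
      have huT : u ∈ Set.Icc s T := ⟨hu.1.le, hu.2.trans ht.2⟩
      have h1 : ∀ i q, ‖coeff k (w i) q * D u (d + 1) (extWord w i q)‖ ≤
          K * (A * (u - s) ^ n) := by
        intro i q
        rw [norm_mul]
        refine mul_le_mul (hK _ _) ((ih u huT _ _).trans_eq ?_) (norm_nonneg _) hK0
        rw [hA, mul_pow]
        ring
      calc ‖wordSum k (D u) d w‖ ≤ ∑ _i : Fin d, ∑ _q : Fin 4, K * (A * (u - s) ^ n) :=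
            norm_sum_le_of_le _ fun i _ => norm_sum_le_of_le _ fun q _ => h1 i q
        _ = d * 4 * K * A * (u - s) ^ n := by
            simp
            ring
    refine (intervalIntegral.norm_integral_le_of_norm_le ht.1 (Filter.Eventually.of_forall hbd)
      (Continuous.intervalIntegrable (by fun_prop) _ _)).trans_eq ?_
    rw [intervalIntegral.integral_const_mul,
      intervalIntegral.integral_comp_sub_right (fun x => x ^ n) s, integral_pow, sub_self, hA,
      zero_pow n.succ_ne_zero]
    have h2 : (d : ℝ) * (d + 1).ascFactorial n = d.ascFactorial (n + 1) := by
      rw [Nat.ascFactorial_succ]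
      exact_mod_cast Nat.succ_ascFactorial d n
    rw [← h2, Nat.factorial_succ]
    have h3 : (n.factorial : ℝ) ≠ 0 := by exact_mod_cast n.factorial_ne_zero
    push_cast
    simp only [mul_pow]
    field_simp
    ring

theorem eq_zero_of_integral_wordSum_of_le {k : ℕ → ℝ} {K R C s T : ℝ} (hK0 : 0 < K)
    (hK : ∀ n q, |coeff k n q| ≤ K) (hR : 0 < R) {D : ℝ → (d : ℕ) → (Fin d → ℕ) → ℝ}
    (hD : ∀ t ∈ Set.Icc s T, ∀ d w, |D t d w| ≤ C * R ^ d)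
    (hint : ∀ t ∈ Set.Icc s T, ∀ d w, D t d w = ∫ u in s..t, wordSum k (D u) d w)
    {t : ℝ} (ht : t ∈ Set.Icc s T) (hts : t - s ≤ 1 / (16 * K * R)) (d : ℕ) (w : Fin d → ℕ) :
    D t d w = 0 := by
  have hC : 0 ≤ C * R ^ d := (abs_nonneg _).trans (hD t ht d w)
  have hle : ∀ n : ℕ, |D t d w| ≤ C * R ^ d * 2 ^ d * (1 / 2) ^ n := by
    intro n
    have h1 : (d.ascFactorial n : ℝ) / n.factorial ≤ 2 ^ d * 2 ^ n := by
      rw [Nat.ascFactorial_eq_factorial_mul_choose', Nat.cast_mul,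
        mul_div_cancel_left₀ _ (by exact_mod_cast n.factorial_ne_zero), ← pow_add]
      calc ((d + n - 1).choose n : ℝ) ≤ 2 ^ (d + n - 1) := by
            exact_mod_cast Nat.choose_le_two_pow _ _
        _ ≤ 2 ^ (d + n) := pow_le_pow_right₀ one_le_two (Nat.sub_le _ _)
    have h2 : 4 * K * R * (t - s) ≤ 1 / 4 := by
      rw [le_div_iff₀ (by positivity)] at hts
      linarith
    have h3 : 0 ≤ 4 * K * R * (t - s) := mul_nonneg (by positivity) (sub_nonneg.2 ht.1)
    calc |D t d w| ≤ C * R ^ d * (d.ascFactorial n / n.factorial) * (4 * K * R * (t - s)) ^ n :=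
          abs_le_of_integral_wordSum hK hD hint n t ht d w
      _ ≤ C * R ^ d * (2 ^ d * 2 ^ n) * (1 / 4) ^ n := by gcongr
      _ = C * R ^ d * 2 ^ d * (1 / 2) ^ n := by
          rw [show (1 / 2 : ℝ) = 2 * (1 / 4) by norm_num, mul_pow]
          ring
  have hlim : Filter.Tendsto (fun n : ℕ => C * R ^ d * 2 ^ d * (1 / 2 : ℝ) ^ n) Filter.atTop
      (nhds 0) := by
    simpa using (tendsto_pow_atTop_nhds_zero_of_lt_one (r := (1 / 2 : ℝ)) (by norm_num)
      (by norm_num)).const_mul (C * R ^ d * 2 ^ d)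
  exact abs_nonpos_iff.1 (ge_of_tendsto' hlim hle)

/-- A family evolving through the Liouville operator with at most geometric growth in the length of
the words vanishes if it vanishes at time `0`. -/
theorem eq_zero_of_integral_wordSum {k : ℕ → ℝ} {K R C T : ℝ} (hK0 : 0 < K)
    (hK : ∀ n q, |coeff k n q| ≤ K) (hR : 0 < R) {D : ℝ → (d : ℕ) → (Fin d → ℕ) → ℝ}
    (hD : ∀ t ∈ Set.Icc 0 T, ∀ d w, |D t d w| ≤ C * R ^ d) (h0 : ∀ d w, D 0 d w = 0)
    (hint : ∀ s t, 0 ≤ s → s ≤ t → t ≤ T →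
      ∀ d w, D t d w - D s d w = ∫ u in s..t, wordSum k (D u) d w)
    {t : ℝ} (ht : t ∈ Set.Icc 0 T) (d : ℕ) (w : Fin d → ℕ) : D t d w = 0 := by
  set δ : ℝ := 1 / (16 * K * R) with hδ
  have hδ0 : 0 < δ := by positivity
  have key : ∀ j : ℕ, ∀ t ∈ Set.Icc 0 T, t ≤ j * δ → ∀ d w, D t d w = 0 := by
    intro j
    induction j with
    | zero =>
      intro t ht htj
      obtain rfl : t = 0 := le_antisymm (by simpa using htj) ht.1
      exact h0
    | succ j ih =>
      intro t ht htj
      rcases le_total t (j * δ) with h | h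
      · exact ih t ht h
      · have hs0 : 0 ≤ j * δ := by positivity
        have hs : ∀ d w, D (j * δ) d w = 0 := ih _ ⟨hs0, h.trans ht.2⟩ le_rfl
        refine eq_zero_of_integral_wordSum_of_le hK0 hK hR (s := j * δ) (T := T) (C := C)
          (fun u hu => hD u ⟨hs0.trans hu.1, hu.2⟩) (fun u hu d w => ?_) ⟨h, ht.2⟩ ?_
        · rw [← hint _ _ hs0 hu.1 hu.2 d w, hs, sub_zero]
        · push_cast at htj
          linarith
  obtain ⟨j, hj⟩ := exists_nat_ge (t / δ)
  exact key j t ht ((div_le_iff₀ hδ0).1 hj) d w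

/-- The sequence with components `x` at the indices `1, …, N` and `0` elsewhere. -/
def embed (N : ℕ) (x : Fin N → ℝ) (n : ℕ) : ℝ :=
  if h : 1 ≤ n ∧ n ≤ N then x ⟨n - 1, by omega⟩ else 0

theorem embed_succ {N : ℕ} (x : Fin N → ℝ) (i : Fin N) : embed N x (i + 1) = x i := by
  simp [embed, Nat.succ_le_of_lt i.2]

theorem embed_of_lt {N n : ℕ} (x : Fin N → ℝ) (h : N < n) : embed N x n = 0 := by
  simp [embed, h]

theorem embed_comp_succ {N : ℕ} {y : ℕ → ℝ} (h0 : y 0 = 0) (hN : ∀ n, N < n → y n = 0) :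
    embed N (fun i => y (i + 1)) = y := by
  funext n
  by_cases h : 1 ≤ n ∧ n ≤ N
  · simp [embed, h]
  · rcases Nat.eq_zero_or_pos n with rfl | hn
    · simp [embed, h0]
    · simp [embed, h, hN n (by omega)]

theorem contDiff_embed {N : ℕ} (n : ℕ) : ContDiff ℝ 1 fun x : Fin N → ℝ => embed N x n := by
  unfold embed
  split_ifs <;> fun_prop

theorem continuous_embed (N : ℕ) : Continuous (embed N) :=
  continuous_pi fun n => (contDiff_embed n).continuous

theorem embed_add_smul {N : ℕ} (x v : Fin N → ℝ) (u : ℝ) (n : ℕ) :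
    embed N (x + u • v) n = embed N x n + u * embed N v n := by
  unfold embed
  split_ifs <;> simp

theorem hasDerivAt_embed_line {N : ℕ} (x v : Fin N → ℝ) (n : ℕ) :
    HasDerivAt (fun u : ℝ => embed N (x + u • v) n) (embed N v n) 0 := by
  simp only [embed_add_smul]
  simpa using ((hasDerivAt_id (0 : ℝ)).mul_const (embed N v n)).const_add (embed N x n)

theorem sum_range_eq_sum_fin {N : ℕ} {f : ℕ → ℝ} (h0 : f 0 = 0) :
    ∑ n ∈ Finset.range (N + 1), f n = ∑ i : Fin N, f (i + 1) := by
  rw [Finset.sum_range_succ', h0, add_zero, Finset.sum_range]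

theorem energy_embed {N : ℕ} (x : Fin N → ℝ) : energy N (embed N x) = ∑ i, x i ^ 2 := by
  unfold energy
  rw [sum_range_eq_sum_fin (by simp [embed])]
  simp [embed_succ]

theorem contDiff_testFun_embed {N : ℕ} {θ : ℝ → ℝ} (hθ : ContDiff ℝ 1 θ) (d : ℕ)
    (w : Fin d → ℕ) : ContDiff ℝ 1 fun x : Fin N → ℝ => testFun N θ (embed N x) d w := by
  simp only [testFun, energy_embed]
  refine ContDiff.mul (hθ.comp (by fun_prop)) ?_
  exact contDiff_prod fun i _ => contDiff_embed (w i)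

theorem norm_le_of_energy_embed_le {N : ℕ} {R : ℝ} (hR : 0 ≤ R) {x : Fin N → ℝ}
    (h : energy N (embed N x) ≤ R ^ 2) : ‖x‖ ≤ R := by
  rw [energy_embed] at h
  refine (pi_norm_le_iff_of_nonneg hR).2 fun i => abs_le_of_sq_le_sq (le_trans ?_ h) hR
  exact Finset.single_le_sum (f := fun i => x i ^ 2) (fun i _ => sq_nonneg _) (Finset.mem_univ i)

theorem hasCompactSupport_testFun_embed {N : ℕ} {θ : ℝ → ℝ} {R : ℝ} (hR : 0 ≤ R)
    (h0 : ∀ s, R ^ 2 ≤ s → θ s = 0) (d : ℕ) (w : Fin d → ℕ) :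
    HasCompactSupport fun x : Fin N → ℝ => testFun N θ (embed N x) d w := by
  refine HasCompactSupport.intro (isCompact_closedBall (0 : Fin N → ℝ) R) fun x hx => ?_
  have : R ^ 2 ≤ energy N (embed N x) := by
    by_contra! h
    exact hx (mem_closedBall_zero_iff.2 (norm_le_of_energy_embed_le hR h.le))
  simp [testFun, h0 _ this]

theorem integral_fderiv_apply_eq_zero {N : ℕ} {f : (Fin N → ℝ) → ℝ} (hf : ContDiff ℝ 1 f)
    (hc : HasCompactSupport f) (v : Fin N → ℝ) : ∫ x, fderiv ℝ f x v = 0 := by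
  have hf' : Integrable fun x => fderiv ℝ f x v :=
    ((hf.continuous_fderiv (by simp)).clm_apply continuous_const).integrable_of_hasCompactSupport
      (hc.fderiv_apply (𝕜 := ℝ) v)
  have := integral_mul_fderiv_eq_neg_fderiv_mul_of_integrable (μ := volume) (𝕜 := ℝ)
    (f := fun _ : Fin N → ℝ => (1 : ℝ)) (g := f) (v := v) (by simp) (by simpa using hf')
    (by simpa using hf.continuous.integrable_of_hasCompactSupport hc) (by simp)
    fun x _ => hf.differentiable (by simp) x
  simpa using this

/-- The vector field is divergence free and tangent to the spheres: the Liouville operator has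
vanishing integral against compactly supported radial densities. -/
theorem integral_wordSum_testFun_embed (lam : ℝ) {N : ℕ} {θ : ℝ → ℝ} (hθ : ContDiff ℝ 1 θ) {R : ℝ}
    (hR : 0 ≤ R) (h0 : ∀ s, R ^ 2 ≤ s → θ s = 0) (d : ℕ) (w : Fin d → ℕ) :
    ∫ x : Fin N → ℝ, wordSum (shellK lam N) (testFun N θ (embed N x)) d w = 0 := by
  set k := shellK lam N
  set h : (Fin N → ℝ) → ℝ := fun x => testFun N θ (embed N x) d w with hh
  have hh1 : ContDiff ℝ 1 h := contDiff_testFun_embed hθ d w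
  have hhc : HasCompactSupport h := hasCompactSupport_testFun_embed hR h0 d w
  have hb : ∀ n, ContDiff ℝ 1 fun x : Fin N → ℝ => vectorField k (embed N x) n := by
    intro n
    have := @contDiff_embed N
    unfold vectorField
    fun_prop
  set g : Fin N → (Fin N → ℝ) → ℝ := fun i x => h x * vectorField k (embed N x) (i + 1) with hg
  have hg1 : ∀ i, ContDiff ℝ 1 (g i) := fun i => hh1.mul (hb _)
  have hgc : ∀ i, HasCompactSupport (g i) := fun i => hhc.mul_right
  have hline : ∀ {f : (Fin N → ℝ) → ℝ}, ContDiff ℝ 1 f → ∀ x v,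
      HasDerivAt (fun u : ℝ => f (x + u • v)) (fderiv ℝ f x v) 0 := by
    intro f hf x v
    have := ((hf.differentiable (by simp) x).hasFDerivAt).hasLineDerivAt v
    simpa [HasLineDerivAt] using this
  have hdiv : ∀ x, ∑ i, fderiv ℝ (g i) x (Pi.single i 1) =
      wordSum k (testFun N θ (embed N x)) d w := by
    intro x
    have h1 : ∀ i : Fin N, fderiv ℝ (g i) x (Pi.single i 1) =
        fderiv ℝ h x (Pi.single i 1) * vectorField k (embed N x) (i + 1) +
          h x * (k (i + 1 - 1) * embed N x (i + 1 - 1) - k (i + 1 + 1) * embed N x (i + 1 + 1)) := by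
      intro i
      have hx := fun n => hasDerivAt_embed_line x (Pi.single i (1 : ℝ)) n
      have e1 : embed N (Pi.single i (1 : ℝ)) (i + 1) = 1 := by simp [embed_succ]
      have e2 : ∀ n : ℕ, n ≠ i + 1 → embed N (Pi.single i (1 : ℝ)) n = 0 := by
        intro n hn
        unfold embed
        split_ifs with hnN
        · rw [Pi.single_eq_of_ne]
          rw [Ne, Fin.ext_iff]
          simp only
          omega
        · rfl
      have hv := ((((hx (i + 1 - 1)).fun_pow 2).const_mul (k (i + 1))).fun_sub
        (((hx (i + 1)).const_mul (k (i + 1 + 1))).fun_mul (hx (i + 1 + 1)))).fun_sub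
        (((hx (i + 1 + 1)).fun_pow 2).const_mul (k (i + 1))) |>.fun_add
        (((hx (i + 1 - 1)).const_mul (k (i + 1 - 1))).fun_mul (hx (i + 1)))
      refine (hline (hg1 i) x (Pi.single i 1)).unique
        (((hline hh1 x (Pi.single i 1)).fun_mul hv).congr_deriv ?_)
      rw [e1, e2 (i + 1 - 1) (by omega), e2 (i + 1 + 1) (by omega)]
      simp only [zero_smul, add_zero, vectorField]
      ring
    have h2 : ∑ i : Fin N, fderiv ℝ h x (Pi.single i 1) * vectorField k (embed N x) (i + 1) =
        wordSum k (testFun N θ (embed N x)) d w := by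
      set v : Fin N → ℝ := fun i => vectorField k (embed N x) (i + 1) with hv
      have hvx : embed N v = vectorField k (embed N x) :=
        embed_comp_succ (vectorField_of_notMem lam (fun n hn => embed_of_lt x hn) (by omega))
          fun n hn => vectorField_of_notMem lam (fun n hn => embed_of_lt x hn) (by omega)
      have h3 : ∑ i : Fin N, fderiv ℝ h x (Pi.single i 1) * v i = fderiv ℝ h x v := by
        conv_rhs => rw [pi_eq_sum_univ' v]
        simp [mul_comm, Pi.single]
      rw [h3]
      have h4 := hasDerivWithinAt_testFun lam (N := N) (hθ.differentiable (by simp))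
        (y := fun u : ℝ => embed N (x + u • v)) (s := Set.univ) (t := 0)
        (fun n hn => embed_of_lt _ hn) (fun n => by
          have := (hasDerivAt_embed_line x v n).hasDerivWithinAt (s := Set.univ)
          simpa [hvx] using this) d w
      rw [hasDerivWithinAt_univ] at h4
      simpa using (hline hh1 x v).unique h4
    have h5 := sum_divergence lam N (embed N x)
    rw [sum_range_eq_sum_fin (by simp [shellK_zero, shellK_one])] at h5
    rw [Finset.sum_congr rfl fun i _ => h1 i, Finset.sum_add_distrib, h2, ← Finset.mul_sum, h5,
      mul_zero, add_zero]
  simp only [← hdiv]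
  rw [integral_finsetSum]
  · exact Finset.sum_eq_zero fun i _ => integral_fderiv_apply_eq_zero (hg1 i) (hgc i) _
  · exact fun i _ => (((hg1 i).continuous_fderiv (by simp)).clm_apply
      continuous_const).integrable_of_hasCompactSupport ((hgc i).fderiv_apply (𝕜 := ℝ) _)

theorem pi_gaussianReal_eq_withDensity (N : ℕ) {v : NNReal} (hv : v ≠ 0) :
    Measure.pi (fun _ : Fin N => gaussianReal 0 v) =
      volume.withDensity fun x => ENNReal.ofReal (∏ i, gaussianPDFReal 0 v (x i)) := by
  refine Measure.pi_eq fun s hs => ?_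
  have hprod : volume.restrict (Set.univ.pi s) =
      Measure.pi fun i : Fin N => (volume : Measure ℝ).restrict (s i) := by
    rw [volume_pi, Measure.restrict_pi_pi]
  have hint : ∀ i : Fin N, Integrable (gaussianPDFReal 0 v) (volume.restrict (s i)) :=
    fun i => (integrable_gaussianPDFReal 0 v).integrableOn
  rw [withDensity_apply _ (MeasurableSet.univ_pi hs), ← ofReal_integral_eq_lintegral_ofReal]
  · rw [hprod, integral_fintype_prod_eq_prod fun _ => gaussianPDFReal 0 v,
      ENNReal.ofReal_prod_of_nonneg fun i _ =>
        integral_nonneg fun x => gaussianPDFReal_nonneg 0 v x]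
    exact Finset.prod_congr rfl fun i _ => (gaussianReal_apply_eq_integral 0 hv (s i)).symm
  · rw [hprod]
    exact Integrable.fintype_prod hint
  · exact Filter.Eventually.of_forall fun x =>
      Finset.prod_nonneg fun i _ => gaussianPDFReal_nonneg 0 v (x i)

theorem integral_pi_gaussianReal {N : ℕ} {v : NNReal} (hv : v ≠ 0) (f : (Fin N → ℝ) → ℝ) :
    ∫ x, f x ∂Measure.pi (fun _ : Fin N => gaussianReal 0 v) =
      ∫ x, (√(2 * Real.pi * v))⁻¹ ^ N * Real.exp (-energy N (embed N x) / (2 * v)) * f x := by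
  have hmeas : Measurable fun x : Fin N → ℝ => ∏ i, gaussianPDFReal 0 v (x i) :=
    Finset.measurable_prod _ fun i _ => (measurable_gaussianPDFReal 0 v).comp (measurable_pi_apply i)
  rw [pi_gaussianReal_eq_withDensity N hv, integral_withDensity_eq_integral_toReal_smul
    hmeas.ennreal_ofReal (Filter.Eventually.of_forall fun x => ENNReal.ofReal_lt_top)]
  refine integral_congr_ae (Filter.Eventually.of_forall fun x => ?_)
  simp only
  rw [ENNReal.toReal_ofReal (Finset.prod_nonneg fun i _ => gaussianPDFReal_nonneg 0 v (x i)),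
    energy_embed, smul_eq_mul]
  simp only [gaussianPDFReal, sub_zero, Finset.prod_mul_distrib, ← Real.exp_sum,
    Finset.prod_const, Finset.card_univ, Fintype.card_fin, ← Finset.sum_div,
    Finset.sum_neg_distrib]

/-- The product Gaussian measure is infinitesimally invariant under the shell model. -/
theorem integral_wordSum_testFun_gaussian (lam : ℝ) {N : ℕ} {v : NNReal} (hv : v ≠ 0) {θ : ℝ → ℝ}
    (hθ : ContDiff ℝ 1 θ) {R : ℝ} (hR : 0 ≤ R) (h0 : ∀ s, R ^ 2 ≤ s → θ s = 0) (d : ℕ)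
    (w : Fin d → ℕ) :
    ∫ x, wordSum (shellK lam N) (testFun N θ (embed N x)) d w
      ∂Measure.pi (fun _ : Fin N => gaussianReal 0 v) = 0 := by
  rw [integral_pi_gaussianReal hv]
  set ψ : ℝ → ℝ := fun s => (√(2 * Real.pi * v))⁻¹ ^ N * Real.exp (-s / (2 * v)) * θ s with hψ
  have h1 : ContDiff ℝ 1 ψ := by fun_prop
  rw [← integral_wordSum_testFun_embed lam h1 hR (fun s hs => by simp [hψ, h0 s hs]) d w]
  refine integral_congr_ae (Filter.Eventually.of_forall fun x => ?_)
  simp only [wordSum, testFun, Finset.mul_sum, hψ]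
  exact Finset.sum_congr rfl fun i _ => Finset.sum_congr rfl fun q _ => by ring

theorem integrable_testFun_embed {N : ℕ} {θ : ℝ → ℝ} (hθ : ContDiff ℝ 1 θ) {R : ℝ} (hR : 0 ≤ R)
    (h1 : ∀ s, |θ s| ≤ 1) (h0 : ∀ s, R ^ 2 ≤ s → θ s = 0) (ρ : Measure (Fin N → ℝ))
    [IsFiniteMeasure ρ] (d : ℕ) (w : Fin d → ℕ) :
    Integrable (fun x => testFun N θ (embed N x) d w) ρ :=
  .of_bound (contDiff_testFun_embed hθ d w).continuous.aestronglyMeasurable (R ^ d)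
    (Filter.Eventually.of_forall fun x => abs_testFun_le hR h1 h0 (fun _ hn => embed_of_lt x hn) d w)

theorem mul_pow_eq_sum_testFun {N : ℕ} (θ : ℝ → ℝ) (L : StrongDual ℝ (Fin N → ℝ)) (k : ℕ)
    (x : Fin N → ℝ) : θ (energy N (embed N x)) * L x ^ k =
      ∑ p : Fin k → Fin N, (∏ l, L (Pi.single (p l) 1)) *
        testFun N θ (embed N x) k (fun l => p l + 1) := by
  have hL : L x = ∑ i, L (Pi.single i 1) * x i := by
    conv_lhs => rw [pi_eq_sum_univ' x]
    simp [mul_comm, Pi.single]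
  rw [hL, Finset.sum_pow', Fintype.piFinset_univ, Finset.mul_sum]
  refine Finset.sum_congr rfl fun p _ => ?_
  simp only [testFun, embed_succ, Finset.prod_mul_distrib]
  ring

theorem hasSum_integral_mul_exp {N : ℕ} {θ : ℝ → ℝ} (hθ : ContDiff ℝ 1 θ) {R : ℝ} (hR : 0 ≤ R)
    (h1 : ∀ s, |θ s| ≤ 1) (h0 : ∀ s, R ^ 2 ≤ s → θ s = 0) (ρ : Measure (Fin N → ℝ))
    [IsFiniteMeasure ρ] (L : StrongDual ℝ (Fin N → ℝ)) :
    HasSum (fun k : ℕ => ((∑ p : Fin k → Fin N, (∏ l, L (Pi.single (p l) 1)) *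
        ∫ x, testFun N θ (embed N x) k (fun l => p l + 1) ∂ρ : ℝ) : ℂ) *
          (Complex.I ^ k / k.factorial))
      (∫ x, (θ (energy N (embed N x)) : ℂ) * Complex.exp (L x * Complex.I) ∂ρ) := by
  have hcont : Continuous fun x : Fin N → ℝ => θ (energy N (embed N x)) := by
    simp only [energy_embed]
    exact hθ.continuous.comp (by fun_prop)
  have key := hasSum_integral_of_dominated_convergence (μ := ρ)
    (F := fun (k : ℕ) (x : Fin N → ℝ) => ((θ (energy N (embed N x)) * L x ^ k : ℝ) : ℂ) *
      (Complex.I ^ k / k.factorial))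
    (f := fun x => (θ (energy N (embed N x)) : ℂ) * Complex.exp (L x * Complex.I))
    (fun k _ => (‖L‖ * R) ^ k / k.factorial)
    (fun k => by
      exact ((Complex.continuous_ofReal.comp (hcont.mul (L.continuous.pow k))).mul
        continuous_const).aestronglyMeasurable)
    (fun k => Filter.Eventually.of_forall fun x => ?_)
    (Filter.Eventually.of_forall fun _ => Real.summable_pow_div_factorial _)
    (integrable_const _)
    (Filter.Eventually.of_forall fun x => ?_)
  · refine key.congr_fun fun k => ?_
    rw [integral_mul_const, integral_complex_ofReal]
    congr 2
    simp only [mul_pow_eq_sum_testFun]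
    rw [integral_finsetSum _ fun p _ =>
      (integrable_testFun_embed hθ hR h1 h0 ρ k _).const_mul _]
    exact Finset.sum_congr rfl fun p _ => (integral_const_mul _ _).symm
  · rw [norm_mul, norm_div, norm_pow, Complex.norm_I, one_pow, Complex.norm_natCast,
      Complex.norm_real, norm_mul, norm_pow, mul_one_div]
    gcongr
    rcases le_total (R ^ 2) (energy N (embed N x)) with h | h
    · rw [h0 _ h, norm_zero, zero_mul]
      positivity
    · calc ‖θ (energy N (embed N x))‖ * ‖L x‖ ^ k ≤ 1 * (‖L‖ * R) ^ k := by
            gcongr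
            · exact h1 _
            · exact (L.le_opNorm x).trans (by gcongr; exact norm_le_of_energy_embed_le hR h)
        _ = (‖L‖ * R) ^ k := one_mul _
  · rw [Complex.exp_eq_exp_ℂ]
    refine ((NormedSpace.expSeries_div_hasSum_exp (𝔸 := ℂ) (L x * Complex.I)).mul_left
      (θ (energy N (embed N x)) : ℂ)).congr_fun fun k => ?_
    rw [mul_pow]
    push_cast
    ring

/-- Radially truncated monomials determine a finite measure. -/
theorem measure_eq_of_integral_testFun {N : ℕ} {μ ν : Measure (Fin N → ℝ)} [IsFiniteMeasure μ]
    [IsFiniteMeasure ν]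
    (h : ∀ (θ : ℝ → ℝ) (R : ℝ), ContDiff ℝ 1 θ → 0 < R → (∀ s, |θ s| ≤ 1) →
      (∀ s, R ^ 2 ≤ s → θ s = 0) → ∀ (d : ℕ) (w : Fin d → ℕ),
        ∫ x, testFun N θ (embed N x) d w ∂μ = ∫ x, testFun N θ (embed N x) d w ∂ν) : μ = ν := by
  refine Measure.ext_of_charFunDual (funext fun L => ?_)
  rw [charFunDual_apply, charFunDual_apply]
  set θ : ℕ → ℝ → ℝ := fun n s => Real.smoothTransition (n + 1 - s) with hθ
  have hθ1 : ∀ n, ContDiff ℝ 1 (θ n) := fun n =>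
    (Real.smoothTransition.contDiff (n := 1)).comp (by fun_prop)
  have hθb : ∀ n s, |θ n s| ≤ 1 := fun n s => by
    rw [abs_of_nonneg (Real.smoothTransition.nonneg _)]
    exact Real.smoothTransition.le_one _
  have hθ0 : ∀ (n : ℕ) s, √(n + 1) ^ 2 ≤ s → θ n s = 0 := by
    intro n s hs
    rw [Real.sq_sqrt (by positivity)] at hs
    exact Real.smoothTransition.zero_of_nonpos (by linarith)
  have heq : ∀ n, ∫ x, (θ n (energy N (embed N x)) : ℂ) * Complex.exp (L x * Complex.I) ∂μ =
      ∫ x, (θ n (energy N (embed N x)) : ℂ) * Complex.exp (L x * Complex.I) ∂ν := by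
    intro n
    have h1 := hasSum_integral_mul_exp (hθ1 n) (Real.sqrt_nonneg _) (hθb n) (hθ0 n) μ L
    simp only [h (θ n) _ (hθ1 n) (Real.sqrt_pos.2 n.cast_add_one_pos) (hθb n) (hθ0 n)] at h1
    exact h1.unique (hasSum_integral_mul_exp (hθ1 n) (Real.sqrt_nonneg _) (hθb n) (hθ0 n) ν L)
  have hlim : ∀ (ρ : Measure (Fin N → ℝ)) [IsFiniteMeasure ρ], Filter.Tendsto
      (fun n => ∫ x, (θ n (energy N (embed N x)) : ℂ) * Complex.exp (L x * Complex.I) ∂ρ)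
      Filter.atTop (nhds (∫ x, Complex.exp (L x * Complex.I) ∂ρ)) := by
    intro ρ _
    refine tendsto_integral_of_dominated_convergence (fun _ => 1) (fun n => ?_)
      (integrable_const _) (fun n => Filter.Eventually.of_forall fun x => ?_)
      (Filter.Eventually.of_forall fun x => ?_)
    · refine Continuous.aestronglyMeasurable ?_
      have := L.continuous
      have := (hθ1 n).continuous
      simp only [energy_embed]
      fun_prop
    · rw [norm_mul, Complex.norm_exp_ofReal_mul_I, mul_one, Complex.norm_real]
      exact hθb n _
    · refine tendsto_const_nhds.congr' ?_
      obtain ⟨m, hm⟩ := exists_nat_ge (energy N (embed N x))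
      filter_upwards [Filter.eventually_ge_atTop m] with n hn
      have hmn : (m : ℝ) ≤ n := by exact_mod_cast hn
      have : θ n (energy N (embed N x)) = 1 :=
        Real.smoothTransition.one_of_one_le (by linarith)
      rw [this, Complex.ofReal_one, one_mul]
  have hμ := hlim μ
  simp only [heq] at hμ
  exact tendsto_nhds_unique hμ (hlim ν)

theorem integrable_wordSum {α : Type*} [MeasurableSpace α] {ρ : Measure α} (k : ℕ → ℝ)
    {F : α → (d : ℕ) → (Fin d → ℕ) → ℝ} (hF : ∀ d w, Integrable (fun a => F a d w) ρ) (d : ℕ)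
    (w : Fin d → ℕ) : Integrable (fun a => wordSum k (F a) d w) ρ :=
  integrable_finsetSum _ fun _ _ => integrable_finsetSum _ fun _ _ => (hF _ _).const_mul _

theorem integral_wordSum {α : Type*} [MeasurableSpace α] {ρ : Measure α} (k : ℕ → ℝ)
    {F : α → (d : ℕ) → (Fin d → ℕ) → ℝ} (hF : ∀ d w, Integrable (fun a => F a d w) ρ) (d : ℕ)
    (w : Fin d → ℕ) :
    ∫ a, wordSum k (F a) d w ∂ρ = wordSum k (fun d w => ∫ a, F a d w ∂ρ) d w := by
  unfold wordSum
  rw [integral_finsetSum _ fun _ _ => integrable_finsetSum _ fun _ _ => (hF _ _).const_mul _]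
  refine Finset.sum_congr rfl fun i _ => ?_
  rw [integral_finsetSum _ fun _ _ => (hF _ _).const_mul _]
  exact Finset.sum_congr rfl fun q _ => integral_const_mul _ _

theorem wordSum_sub (k : ℕ → ℝ) (F G : (d : ℕ) → (Fin d → ℕ) → ℝ) (d : ℕ) (w : Fin d → ℕ) :
    wordSum k (fun d w => F d w - G d w) d w = wordSum k F d w - wordSum k G d w := by
  simp only [wordSum, mul_sub, Finset.sum_sub_distrib]

theorem measurable_testFun {N : ℕ} {θ : ℝ → ℝ} (hθ : Continuous θ) (d : ℕ) (w : Fin d → ℕ) :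
    Measurable fun x : ℕ → ℝ => testFun N θ x d w := by
  unfold testFun energy
  exact Continuous.measurable (by fun_prop)

/-- Every component of a solution solves the differential equation, including those outside
`1, …, N`. -/
theorem _root_.IsShellSolution.hasDerivWithinAt {lam T : ℝ} {N : ℕ} {X : ℝ → ℕ → ℝ}
    (hX : IsShellSolution lam N T X) (hX0 : ∀ t n, N < n → X t n = 0) {t : ℝ}
    (ht : t ∈ Set.Icc 0 T) (n : ℕ) :
    HasDerivWithinAt (fun u => X u n) (vectorField (shellK lam N) (X t) n) (Set.Icc 0 T) t := by
  by_cases hn : 1 ≤ n ∧ n ≤ N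
  · exact hX.2.2 n hn.1 hn.2 t ht
  · have : (fun u => X u n) = fun _ => 0 := by
      funext u
      rcases Nat.eq_zero_or_pos n with rfl | hpos
      · exact hX.1 u
      · exact hX0 u n (by omega)
    rw [vectorField_of_notMem lam (hX0 t) hn, this]
    exact hasDerivWithinAt_const _ _ _

section RandomSolution

variable {lam T r : ℝ} {N : ℕ} {Ω : Type*} [MeasurableSpace Ω] {P : Measure Ω}
  {U : Ω → ℝ → ℕ → ℝ} {θ : ℝ → ℝ} {R : ℝ}

theorem _root_.IsNFiniteRandomSolution.measurable_path
    (hU : IsNFiniteRandomSolution lam T r N P U) (t : ℝ) : Measurable fun ω => U ω t :=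
  hU.1.comp measurable_prodMk_right

theorem _root_.IsNFiniteRandomSolution.embed_path
    (hU : IsNFiniteRandomSolution lam T r N P U) (ω : Ω) (t : ℝ) :
    embed N (fun i => U ω t (i + 1)) = U ω t :=
  embed_comp_succ ((hU.2.2.1 ω).1 t) (hU.2.1 ω t)

theorem _root_.IsNFiniteRandomSolution.integrable_testFun [IsFiniteMeasure P]
    (hU : IsNFiniteRandomSolution lam T r N P U) (hθ : Continuous θ) (hR : 0 ≤ R)
    (h1 : ∀ s, |θ s| ≤ 1) (h0 : ∀ s, R ^ 2 ≤ s → θ s = 0) (t : ℝ) (d : ℕ) (w : Fin d → ℕ) :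
    Integrable (fun ω => testFun N θ (U ω t) d w) P :=
  .of_bound ((measurable_testFun hθ d w).comp (hU.measurable_path t)).aestronglyMeasurable (R ^ d)
    (Filter.Eventually.of_forall fun ω => abs_testFun_le hR h1 h0 (hU.2.1 ω t) d w)

theorem _root_.IsNFiniteRandomSolution.integrable_prod_testFun [IsFiniteMeasure P]
    (hU : IsNFiniteRandomSolution lam T r N P U) (hθ : Continuous θ) (hR : 0 ≤ R)
    (h1 : ∀ s, |θ s| ≤ 1) (h0 : ∀ s, R ^ 2 ≤ s → θ s = 0) (ρ : Measure ℝ) [IsFiniteMeasure ρ]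
    (d : ℕ) (w : Fin d → ℕ) :
    Integrable (fun p : ℝ × Ω => testFun N θ (U p.2 p.1) d w) (ρ.prod P) :=
  .of_bound ((measurable_testFun hθ d w).comp (hU.1.comp measurable_swap)).aestronglyMeasurable
    (R ^ d) (Filter.Eventually.of_forall fun p => abs_testFun_le hR h1 h0 (hU.2.1 p.2 p.1) d w)

/-- The Liouville equation, in integrated form. -/
theorem _root_.IsNFiniteRandomSolution.integral_testFun_sub [IsFiniteMeasure P]
    (hU : IsNFiniteRandomSolution lam T r N P U) (hθ : ContDiff ℝ 1 θ) (hR : 0 ≤ R)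
    (h1 : ∀ s, |θ s| ≤ 1) (h0 : ∀ s, R ^ 2 ≤ s → θ s = 0) {s t : ℝ} (hs : 0 ≤ s) (hst : s ≤ t)
    (ht : t ≤ T) (d : ℕ) (w : Fin d → ℕ) :
    ∫ ω, testFun N θ (U ω t) d w ∂P - ∫ ω, testFun N θ (U ω s) d w ∂P =
      ∫ u in s..t, wordSum (shellK lam N) (fun d w => ∫ ω, testFun N θ (U ω u) d w ∂P) d w := by
  have hint := hU.integrable_testFun hθ.continuous hR h1 h0
  have hftc : ∀ ω, ∫ u in s..t, wordSum (shellK lam N) (testFun N θ (U ω u)) d w =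
      testFun N θ (U ω t) d w - testFun N θ (U ω s) d w := by
    intro ω
    have hder : ∀ u ∈ Set.Icc 0 T, ∀ d w, HasDerivWithinAt (fun u => testFun N θ (U ω u) d w)
        (wordSum (shellK lam N) (testFun N θ (U ω u)) d w) (Set.Icc 0 T) u :=
      fun u hu => hasDerivWithinAt_testFun lam (hθ.differentiable one_ne_zero) (hU.2.1 ω u)
        ((hU.2.2.1 ω).hasDerivWithinAt (hU.2.1 ω) hu)
    have hcont : ∀ d w, ContinuousOn (fun u => testFun N θ (U ω u) d w) (Set.Icc s t) :=
      fun d w u hu => ((hder u ⟨hs.trans hu.1, hu.2.trans ht⟩ d w).continuousWithinAt).mono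
        (Set.Icc_subset_Icc hs ht)
    refine intervalIntegral.integral_eq_sub_of_hasDeriv_right_of_le hst (hcont d w)
      (fun u hu => ?_) ?_
    · exact (hder u ⟨hs.trans hu.1.le, hu.2.le.trans ht⟩ d w).mono_of_mem_nhdsWithin
        (mem_nhdsWithin_of_mem_nhds
          (Icc_mem_nhds (hs.trans_lt hu.1) (hu.2.trans_le ht)))
    · refine ContinuousOn.intervalIntegrable_of_Icc hst ?_
      exact continuousOn_finsetSum _ fun _ _ => continuousOn_finsetSum _ fun _ _ =>
        continuousOn_const.mul (hcont _ _)
  rw [← integral_sub (hint t d w) (hint s d w)]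
  simp only [← hftc]
  rw [← intervalIntegral_integral_swap]
  · exact intervalIntegral.integral_congr fun u _ => integral_wordSum _ (hint u) d w
  · rw [Set.uIoc_of_le hst]
    exact integrable_wordSum _
      (hU.integrable_prod_testFun hθ.continuous hR h1 h0 (volume.restrict (Set.Ioc s t))) d w

theorem _root_.IsNFiniteRandomSolution.integral_testFun_eq [IsProbabilityMeasure P]
    (hU : IsNFiniteRandomSolution lam T r N P U) (hlam : 1 < lam) (hr : r ≠ 0)
    (hθ : ContDiff ℝ 1 θ) (hR : 0 < R) (h1 : ∀ s, |θ s| ≤ 1) (h0 : ∀ s, R ^ 2 ≤ s → θ s = 0)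
    {t : ℝ} (ht : t ∈ Set.Icc 0 T) (d : ℕ) (w : Fin d → ℕ) :
    ∫ ω, testFun N θ (U ω t) d w ∂P = ∫ x, testFun N θ (embed N x) d w
      ∂Measure.pi fun _ : Fin N => gaussianReal 0 (r ^ 2).toNNReal := by
  have hv : (r ^ 2).toNNReal ≠ 0 := (Real.toNNReal_pos.2 (by positivity)).ne'
  set μ := Measure.pi fun _ : Fin N => gaussianReal 0 (r ^ 2).toNNReal with hμ
  set D : ℝ → (d : ℕ) → (Fin d → ℕ) → ℝ := fun t d w =>
    ∫ ω, testFun N θ (U ω t) d w ∂P - ∫ x, testFun N θ (embed N x) d w ∂μ with hDdef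
  suffices D t d w = 0 from sub_eq_zero.1 this
  refine eq_zero_of_integral_wordSum (K := lam ^ N) (k := shellK lam N) (C := 2) (R := R)
    (by positivity) (abs_coeff_le hlam N) hR (fun t _ d w => ?_) (fun d w => ?_)
    (fun s t hs hst htT d w => ?_) ht d w
  · have hP : |∫ ω, testFun N θ (U ω t) d w ∂P| ≤ R ^ d := by
      simpa using norm_integral_le_of_norm_le_const (μ := P)
        (f := fun ω => testFun N θ (U ω t) d w) (C := R ^ d)
        (Filter.Eventually.of_forall fun ω => abs_testFun_le hR.le h1 h0 (hU.2.1 ω t) d w)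
    have hμ : |∫ x, testFun N θ (embed N x) d w ∂μ| ≤ R ^ d := by
      simpa using norm_integral_le_of_norm_le_const (μ := μ)
        (f := fun x => testFun N θ (embed N x) d w) (C := R ^ d)
        (Filter.Eventually.of_forall fun x => abs_testFun_le hR.le h1 h0
          (fun _ hn => embed_of_lt x hn) d w)
    calc |D t d w| ≤ R ^ d + R ^ d := (abs_sub _ _).trans (add_le_add hP hμ)
      _ = 2 * R ^ d := by ring
  · rw [hDdef]
    simp only
    rw [hμ, ← hU.2.2.2, integral_map, sub_eq_zero]
    · simp only [hU.embed_path]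
    · exact (measurable_pi_lambda _ fun i =>
        (measurable_pi_apply _).comp (hU.measurable_path 0)).aemeasurable
    · exact (contDiff_testFun_embed hθ d w).continuous.aestronglyMeasurable
  · have hzero : ∀ d w, wordSum (shellK lam N)
        (fun d w => ∫ x, testFun N θ (embed N x) d w ∂μ) d w = 0 := fun d w => by
      rw [← integral_wordSum _ (integrable_testFun_embed hθ hR.le h1 h0 μ)]
      exact integral_wordSum_testFun_gaussian lam hv hθ hR.le h0 d w
    simp only [hDdef, wordSum_sub, hzero, sub_zero, sub_sub_sub_cancel_right]
    exact hU.integral_testFun_sub hθ hR.le h1 h0 hs hst htT d w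

/-- The Gaussian product law is preserved in time. -/
theorem _root_.IsNFiniteRandomSolution.map_eq [IsProbabilityMeasure P]
    (hU : IsNFiniteRandomSolution lam T r N P U) (hlam : 1 < lam) (hr : r ≠ 0)
    {t : ℝ} (ht : t ∈ Set.Icc 0 T) :
    Measure.map (fun ω => fun i : Fin N => U ω t (i + 1)) P =
      Measure.pi fun _ : Fin N => gaussianReal 0 (r ^ 2).toNNReal := by
  refine measure_eq_of_integral_testFun fun θ R hθ hR h1 h0 d w => ?_
  rw [← hU.integral_testFun_eq hlam hr hθ hR h1 h0 ht, integral_map]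
  · simp only [hU.embed_path]
  · exact (measurable_pi_lambda _ fun i =>
      (measurable_pi_apply _).comp (hU.measurable_path t)).aemeasurable
  · exact (contDiff_testFun_embed hθ d w).continuous.aestronglyMeasurable

/-- The law of the whole sequence. -/
theorem _root_.IsNFiniteRandomSolution.map_path_eq [IsProbabilityMeasure P]
    (hU : IsNFiniteRandomSolution lam T r N P U) (hlam : 1 < lam) (hr : r ≠ 0)
    {t : ℝ} (ht : t ∈ Set.Icc 0 T) :
    Measure.map (fun ω => U ω t) P =
      (Measure.pi fun _ : Fin N => gaussianReal 0 (r ^ 2).toNNReal).map (embed N) := by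
  have hmeas : Measurable fun ω => fun i : Fin N => U ω t (i + 1) :=
    measurable_pi_lambda _ fun i => (measurable_pi_apply _).comp (hU.measurable_path t)
  rw [← hU.map_eq hlam hr ht, Measure.map_map (continuous_embed N).measurable hmeas]
  congr 1
  funext ω
  exact (hU.embed_path ω t).symm

end RandomSolution

/-- The finite-dimensional marginals of the law of `embed N` under a product measure. -/
theorem map_embed_pi {N : ℕ} (ν : Measure ℝ) [IsProbabilityMeasure ν] (m : ℕ) :
    (Measure.pi fun _ : Fin N => ν).map (fun x => fun i : Fin m => embed N x (i + 1)) =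
      Measure.pi fun i : Fin m => if (i : ℕ) + 1 ≤ N then ν else Measure.dirac (0 : ℝ) := by
  have : ∀ i : Fin m, IsProbabilityMeasure
      (if (i : ℕ) + 1 ≤ N then ν else Measure.dirac (0 : ℝ)) := fun i => by
    split_ifs <;> infer_instance
  have hmeas : Measurable fun (x : Fin N → ℝ) => fun i : Fin m => embed N x (i + 1) :=
    measurable_pi_lambda _ fun i => (contDiff_embed _).continuous.measurable
  refine (Measure.pi_eq fun s hs => ?_).symm
  rw [Measure.map_apply hmeas (.univ_pi hs)]
  by_cases h : ∀ i : Fin m, N < (i : ℕ) + 1 → (0 : ℝ) ∈ s i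
  · have hpre : (fun x => fun i : Fin m => embed N x (i + 1)) ⁻¹' Set.univ.pi s =
        Set.univ.pi fun j : Fin N => if hj : (j : ℕ) < m then s ⟨j, hj⟩ else Set.univ := by
      ext x
      simp only [Set.mem_preimage, Set.mem_univ_pi]
      constructor
      · intro hx j
        split_ifs with hj
        · simpa [embed_succ] using hx ⟨j, hj⟩
        · trivial
      · intro hx i
        rcases lt_or_ge N ((i : ℕ) + 1) with hi | hi
        · rw [embed_of_lt x hi]
          exact h i hi
        · have := hx ⟨i, hi⟩
          simp only [i.2, dif_pos] at this
          exact (embed_succ x ⟨i, hi⟩).symm ▸ this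
    rw [hpre, Measure.pi_pi]
    set f : ℕ → ENNReal := fun n => if hn : n < m then
      (if n + 1 ≤ N then ν else Measure.dirac 0) (s ⟨n, hn⟩) else 1 with hf
    have hr : ∏ i : Fin m, (if (i : ℕ) + 1 ≤ N then ν else Measure.dirac 0) (s i) =
        ∏ n ∈ Finset.range m, f n := by
      rw [Finset.prod_range]
      simp [hf]
    have hl : ∏ j : Fin N, ν (if hj : (j : ℕ) < m then s ⟨j, hj⟩ else Set.univ) =
        ∏ n ∈ Finset.range N, f n := by
      rw [Finset.prod_range]
      refine Finset.prod_congr rfl fun j _ => ?_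
      simp only [hf, Nat.succ_le_of_lt j.2, if_true]
      split_ifs <;> simp
    rw [hl, hr]
    rcases le_total N m with hNm | hNm
    · refine Finset.prod_subset (Finset.range_mono hNm) fun n hn hn' => ?_
      rw [Finset.mem_range] at hn hn'
      simp [hf, hn, show ¬ n < N by omega,
        h ⟨n, hn⟩ (Nat.lt_succ_of_le (not_lt.1 hn'))]
    · refine (Finset.prod_subset (Finset.range_mono hNm) fun n hn hn' => ?_).symm
      rw [Finset.mem_range] at hn'
      simp [hf, hn']
  · push Not at h
    obtain ⟨i, hi, hsi⟩ := h
    have hpre : (fun x => fun i : Fin m => embed N x (i + 1)) ⁻¹' Set.univ.pi s = ∅ := by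
      ext x
      simp only [Set.mem_preimage, Set.mem_univ_pi, Set.mem_empty_iff_false, iff_false]
      intro hx
      exact hsi (embed_of_lt x hi ▸ hx i)
    rw [hpre, measure_empty]
    refine (Finset.prod_eq_zero (Finset.mem_univ i) ?_).symm
    rw [if_neg (by omega), Measure.dirac_apply' _ (hs i), Set.indicator_of_notMem hsi]

end ShellModel

/-- for an `N`-finite random solution, the law on `ℝ^{ℕ≥1}` of
`ω ↦ (U_n(ω,t))_{n≥1}` is, for every `t ∈ [0,T]`, the product measure
`μ̃_r^N = (⊗_{n=1}^N N(0,r²)) ⊗ (⊗_{n>N} δ_0)` — expressed here through all its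
finite-dimensional marginals, which determine it uniquely — and in particular the law
does not depend on `t`. -/
theorem nfinite_random_solution_law (lam T r : ℝ) (hlam : 1 < lam) (hT : 0 < T)
    (hr : 0 < r) (N : ℕ) (hN : 1 ≤ N) {Ω : Type*} [MeasurableSpace Ω]
    (P : Measure Ω) [IsProbabilityMeasure P] (U : Ω → ℝ → ℕ → ℝ)
    (hU : IsNFiniteRandomSolution lam T r N P U) :
    (∀ t ∈ Set.Icc (0 : ℝ) T, ∀ m : ℕ,
      Measure.map (fun ω => fun i : Fin m => U ω t ((i : ℕ) + 1)) P
        = Measure.pi fun i : Fin m =>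
            if (i : ℕ) + 1 ≤ N then gaussianReal 0 (r ^ 2).toNNReal
            else Measure.dirac (0 : ℝ)) ∧
    (∀ t₁ ∈ Set.Icc (0 : ℝ) T, ∀ t₂ ∈ Set.Icc (0 : ℝ) T,
      Measure.map (fun ω => fun n : ℕ => U ω t₁ (n + 1)) P
        = Measure.map (fun ω => fun n : ℕ => U ω t₂ (n + 1)) P) := by
  have hshift : ∀ {ι : Type} (g : ι → ℕ) (t : ℝ), t ∈ Set.Icc (0 : ℝ) T →
      Measure.map (fun ω => fun i => U ω t (g i)) P =
        (Measure.pi fun _ : Fin N => gaussianReal 0 (r ^ 2).toNNReal).map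
          (fun x => fun i => ShellModel.embed N x (g i)) := by
    intro ι g t ht
    have hg : Measurable fun (x : ℕ → ℝ) => fun i => x (g i) :=
      measurable_pi_lambda _ fun i => measurable_pi_apply _
    have := congrArg (Measure.map fun (x : ℕ → ℝ) => fun i => x (g i))
      (hU.map_path_eq hlam hr.ne' ht)
    rwa [Measure.map_map hg (hU.measurable_path t),
      Measure.map_map hg (ShellModel.continuous_embed N).measurable] at this
  refine ⟨fun t ht m => ?_, fun t₁ ht₁ t₂ ht₂ => ?_⟩
  · rw [hshift (fun i : Fin m => (i : ℕ) + 1) t ht]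
    exact ShellModel.map_embed_pi _ m
  · rw [hshift (fun n : ℕ => n + 1) t₁ ht₁, hshift (fun n : ℕ => n + 1) t₂ ht₂]
end
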